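/- For every c > 0 and every p ∈ [0,1], c·p·(1−p) = inf_{ξ ∈ ℝ} ( ξp + c ψ(ξ/c) ); that is, the Hamiltonian c f(p) with f(p) = p(1−p) is recovered from the Lagrangian (c,ξ) ↦ c ψ(ξ/c) by the Fenchel duality relation. -/

import Mathlib

/-- `ψ(y)`: the negative Legendre dual of the TASEP flux, given piecewise. -/
noncomputable def psi (y : ℝ) : ℝ :=
  if y < -1 then -y else if y ≤ 1 then (1 - y) ^ 2 / 4 else 0

/-- Fenchel duality: for every `c > 0` and `p ∈ [0,1]`,
`c·p·(1−p) = inf_{ξ ∈ ℝ} ( ξp + c ψ(ξ/c) )`. -/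
theorem stmt_3 (c : ℝ) (hc : 0 < c) (p : ℝ) (hp : p ∈ Set.Icc (0 : ℝ) 1) :
    c * p * (1 - p) = ⨅ ξ : ℝ, (ξ * p + c * psi (ξ / c)) := by
  obtain ⟨h0, h1⟩ := hp
  have key : ∀ y : ℝ, p * (1 - p) ≤ y * p + psi y := by
    intro y
    unfold psi
    split_ifs with h2 h3
    · nlinarith [mul_nonneg (sub_nonneg.2 h1) (sub_nonneg.2 h1),
        mul_nonneg (sub_nonneg.2 h1) (sub_nonneg.2 h2.le)]
    · nlinarith [sq_nonneg (1 - y - 2 * p)]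
    · push Not at h3
      nlinarith [mul_nonneg h0 (sub_nonneg.2 h3.le), sq_nonneg p]
  have lb : ∀ ξ : ℝ, c * p * (1 - p) ≤ ξ * p + c * psi (ξ / c) := by
    intro ξ
    have h := mul_le_mul_of_nonneg_left (key (ξ / c)) hc.le
    have e : c * (ξ / c * p + psi (ξ / c)) = ξ * p + c * psi (ξ / c) := by
      field_simp
    rw [e] at h
    linarith
  apply le_antisymm
  · exact le_ciInf lb
  · refine (ciInf_le ⟨_, Set.forall_mem_range.2 lb⟩ (c * (1 - 2 * p))).trans (le_of_eq ?_)
    have e : c * (1 - 2 * p) / c = 1 - 2 * p := by field_simp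
    rw [e]
    unfold psi
    rw [if_neg (by linarith), if_pos (by linarith)]
    ring
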